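/- arXiv:1511.03821 — 2 statements merged into one kernel-verified Lean document; each statement's English description precedes it below -/
import Mathlib

section
/- Let x⁽⁰⁾ ∈ Kⁿ have pairwise distinct components and satisfy E_f(x⁽⁰⁾) < 1/(a + b) and φ(E_f(x⁽⁰⁾)) ≤ 1, where φ(t) = (a t² / ((1 − (a+1)t)(1 − (a+b)t))) · (1 + a t/((n−1)(1 − (a+b)t)))^{n−1}. Then the Ehrlich iteration x⁽ᵏ⁺¹⁾ = Φ(x⁽ᵏ⁾) is well defined for all k ≥ 0, satisfies ‖x⁽ᵏ⁾ − x⁽⁰⁾‖ ⪯ (γ(E_f(x⁽⁰⁾))/(1 − β(E_f(x⁽⁰⁾))))·‖W_f(x⁽⁰⁾)‖ with γ(t) = 1/(1 − a t) and β(t) = (a t² / ((1 − a t)(1 − (a+1)t)))·(1 + a t/((n−1)(1 − (a+b)t)))^{n−1}, and converges to a root vector ξ of f; moreover for all k ≥ 0, ‖x⁽ᵏ⁾ − ξ‖ ⪯ A_k · (θᵏ λ^{(3ᵏ−1)/2} / (1 − θ λ^{3ᵏ})) · ‖W_f(x⁽⁰⁾)‖, where λ = φ(E_f(x⁽⁰⁾)),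 θ = (1 − (a+b)E_f(x⁽⁰⁾))/(1 − a E_f(x⁽⁰⁾)) and A_k = γ(E_f(x⁽⁰⁾)·λ^{(3ᵏ−1)/2}). (Theorem 3.4 (i),(ii)) -/
open Finset Polynomial Filter

noncomputable section

/-- The Weierstrass correction `W_i(x) = f(x_i)/(C₀ ∏_{j≠i}(x_i − x_j))`. -/
def Wc {n : ℕ} {K : Type*} [NormedField K] (f : Polynomial K) (x : Fin n → K) (i : Fin n) : K :=
  eval (x i) f / (f.leadingCoeff * ∏ j ∈ univ.erase i, (x i - x j))

/-- `dmin x i = min_{j ≠ i} ‖x i - x j‖`. -/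
def dmin {n : ℕ} {K : Type*} [NormedField K] (x : Fin n → K) (i : Fin n) : ℝ :=
  if h : (univ.erase i).Nonempty then (univ.erase i).inf' h fun j => ‖x i - x j‖ else 0

/-- `E_f(x)` : the ℓ^p norm of the vector `(‖W_i(x)‖ / d_i(x))_i`. -/
def Ef {n : ℕ} {K : Type*} [NormedField K] (p : ENNReal) (f : Polynomial K)
    (x : Fin n → K) : ℝ :=
  ‖(WithLp.equiv p (Fin n → ℝ)).symm (fun i => ‖Wc f x i‖ / dmin x i)‖

/-- `σ_i(x) = Σ_{j≠i} W_j(x)/(x_i − x_j)`. -/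
def sigmaf {n : ℕ} {K : Type*} [NormedField K] (f : Polynomial K) (x : Fin n → K)
    (i : Fin n) : K :=
  ∑ j ∈ univ.erase i, Wc f x j / (x i - x j)

/-- The Ehrlich iteration function. -/
def PhiE {n : ℕ} {K : Type*} [NormedField K] (f : Polynomial K) (x : Fin n → K) : Fin n → K :=
  fun i => x i - Wc f x i / (1 + sigmaf f x i)

/-- The Prešić–Tanabe iteration function. -/
def TnbE {n : ℕ} {K : Type*} [NormedField K] (f : Polynomial K) (x : Fin n → K) : Fin n → K :=
  fun i => x i - Wc f x i * (1 - sigmaf f x i)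

/-- `ξ` is a root vector of `f`, i.e. `f(z) = C₀ ∏ (z − ξᵢ)`. -/
def IsRootVector {n : ℕ} {K : Type*} [NormedField K] (f : Polynomial K) (ξ : Fin n → K) : Prop :=
  f = C f.leadingCoeff * ∏ i, (X - C (ξ i))

/-- `E_f(x)` in the case `p = ∞`: the max of `‖W_i(x)‖ / d_i(x)`. -/
def Einf {n : ℕ} {K : Type*} [NormedField K] (f : Polynomial K) (x : Fin n → K) : ℝ :=
  if h : (univ : Finset (Fin n)).Nonempty then univ.sup' h fun i => ‖Wc f x i‖ / dmin x i else 0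

theorem prod_one_add_le_pow {ι : Type*} (s : Finset ι) (u : ι → ℝ) (hu : ∀ i ∈ s, 0 ≤ u i) :
    ∏ i ∈ s, (1 + u i) ≤ (1 + (∑ i ∈ s, u i) / #s) ^ #s := by
  rcases s.eq_empty_or_nonempty with rfl | hs
  · simp
  have hc : (0 : ℝ) < #s := by exact_mod_cast hs.card_pos
  have hz : ∀ i ∈ s, 0 ≤ 1 + u i := fun i hi => by linarith [hu i hi]
  have h := Real.geom_mean_le_arith_mean s (fun _ => 1) (fun i => 1 + u i)
    (fun _ _ => zero_le_one) (by simpa using hs) hz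
  simp only [Real.rpow_one, sum_const, nsmul_eq_mul, mul_one, one_mul, sum_add_distrib] at h
  have hP : 0 ≤ ∏ i ∈ s, (1 + u i) := prod_nonneg hz
  calc ∏ i ∈ s, (1 + u i) = ((∏ i ∈ s, (1 + u i)) ^ ((#s : ℝ)⁻¹)) ^ #s := by
        rw [Real.rpow_inv_natCast_pow hP hs.card_pos.ne']
    _ ≤ ((#s + ∑ i ∈ s, u i) / #s) ^ #s := by gcongr
    _ = _ := by congr 1; field_simp

theorem toReal_inv_conj {p q : ENNReal} (hpq : p⁻¹ + q⁻¹ = 1) :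
    (q⁻¹).toReal = 1 - (p.toReal)⁻¹ := by
  have hp : p⁻¹ ≠ ⊤ := fun h => by simp [h] at hpq
  have hq : q⁻¹ ≠ ⊤ := fun h => by simp [h] at hpq
  have h := congrArg ENNReal.toReal hpq
  rw [ENNReal.toReal_add hp hq, ENNReal.toReal_one] at h
  rw [← ENNReal.toReal_inv]
  linarith

theorem sum_le_card_rpow_mul_norm {n : ℕ} {p q : ENNReal} [Fact (1 ≤ p)] (hpq : p⁻¹ + q⁻¹ = 1)
    (s : Finset (Fin n)) (hs : s.Nonempty) (u : Fin n → ℝ) (hu : ∀ i, 0 ≤ u i) :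
    ∑ i ∈ s, u i ≤ (#s : ℝ) ^ (q⁻¹).toReal * ‖WithLp.toLp p u‖ := by
  have hp : 1 ≤ p := Fact.out
  have hc : (0 : ℝ) < #s := by exact_mod_cast hs.card_pos
  rw [toReal_inv_conj hpq]
  rcases eq_or_ne p ⊤ with rfl | htop
  · simp only [ENNReal.toReal_top, inv_zero, sub_zero, Real.rpow_one]
    rw [← nsmul_eq_mul]
    refine sum_le_card_nsmul _ _ _ fun i _ => ?_
    simpa [abs_of_nonneg (hu i)] using PiLp.norm_apply_le (WithLp.toLp ⊤ u) i
  · have hr : 1 ≤ p.toReal := by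
      rw [← ENNReal.toReal_one]; exact ENNReal.toReal_mono htop hp
    have hr0 : 0 < p.toReal := by linarith
    rw [PiLp.norm_eq_sum hr0]
    set r := p.toReal
    have h := Real.rpow_sum_le_const_mul_sum_rpow s u hr
    simp only [abs_of_nonneg (hu _)] at h
    have hS : 0 ≤ ∑ i ∈ s, u i := sum_nonneg fun i _ => hu i
    have hS' : 0 ≤ ∑ i ∈ s, u i ^ r := sum_nonneg fun i _ => Real.rpow_nonneg (hu i) _
    calc ∑ i ∈ s, u i = ((∑ i ∈ s, u i) ^ r) ^ r⁻¹ := by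
          rw [Real.rpow_rpow_inv hS hr0.ne']
      _ ≤ ((#s : ℝ) ^ (r - 1) * ∑ i ∈ s, u i ^ r) ^ r⁻¹ := by gcongr
      _ = (#s : ℝ) ^ (1 - r⁻¹) * (∑ i ∈ s, u i ^ r) ^ (1 / r) := by
          rw [Real.mul_rpow (by positivity) hS', ← Real.rpow_mul hc.le, one_div]
          congr 2
          field_simp
      _ ≤ _ := by
          gcongr
          simp only [Real.norm_eq_abs, abs_of_nonneg (hu _)]
          exact sum_le_sum_of_subset_of_nonneg (subset_univ _)
            fun i _ _ => Real.rpow_nonneg (hu i) _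

theorem norm_toLp_le_mul {n : ℕ} {p : ENNReal} [Fact (1 ≤ p)] {c : ℝ} (hc : 0 ≤ c)
    (u v : Fin n → ℝ) (hv : ∀ i, 0 ≤ v i) (h : ∀ i, v i ≤ c * u i) :
    ‖WithLp.toLp p v‖ ≤ c * ‖WithLp.toLp p u‖ := by
  have hp : 1 ≤ p := Fact.out
  have h' : ∀ i, |v i| ≤ c * |u i| := fun i => by
    rw [abs_of_nonneg (hv i)]
    exact (h i).trans (mul_le_mul_of_nonneg_left (le_abs_self _) hc)
  rcases eq_or_ne p ⊤ with rfl | htop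
  · rw [PiLp.norm_eq_ciSup]
    refine Real.iSup_le (fun i => (h' i).trans ?_) (by positivity)
    gcongr
    exact PiLp.norm_apply_le (WithLp.toLp ⊤ u) i
  · have hr : 1 ≤ p.toReal := by
      rw [← ENNReal.toReal_one]; exact ENNReal.toReal_mono htop hp
    have hr0 : 0 < p.toReal := by linarith
    rw [← abs_of_nonneg hc, ← Real.norm_eq_abs, ← norm_smul, PiLp.norm_eq_sum hr0,
      PiLp.norm_eq_sum hr0]
    gcongr with i
    simpa [abs_mul, abs_of_nonneg hc] using h' i

section Weierstrass

variable {n : ℕ} {K : Type*} [NormedField K]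

theorem dmin_le (x : Fin n → K) {i j : Fin n} (hij : j ≠ i) : dmin x i ≤ ‖x i - x j‖ := by
  have hj : j ∈ univ.erase i := by simp [hij]
  rw [dmin, dif_pos ⟨j, hj⟩]
  exact inf'_le (fun j => ‖x i - x j‖) hj

theorem erase_nonempty (hn : 2 ≤ n) (i : Fin n) : (univ.erase i).Nonempty := by
  rw [← card_pos, card_erase_of_mem (mem_univ i), card_univ, Fintype.card_fin]
  omega

theorem le_dmin (hn : 2 ≤ n) (x : Fin n → K) (i : Fin n) {c : ℝ}
    (h : ∀ j, j ≠ i → c ≤ ‖x i - x j‖) : c ≤ dmin x i := by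
  rw [dmin, dif_pos (erase_nonempty hn i)]
  exact le_inf' _ _ fun j hj => h j (ne_of_mem_erase hj)

theorem dmin_nonneg (x : Fin n → K) (i : Fin n) : 0 ≤ dmin x i := by
  rw [dmin]
  split_ifs with h
  · exact le_inf' _ _ fun j _ => norm_nonneg _
  · exact le_rfl

theorem dmin_pos (hn : 2 ≤ n) {x : Fin n → K} (hx : Function.Injective x) (i : Fin n) :
    0 < dmin x i := by
  rw [dmin, dif_pos (erase_nonempty hn i), lt_inf'_iff]
  intro j hj
  exact norm_pos_iff.2 (sub_ne_zero.2 (hx.ne (ne_of_mem_erase hj).symm))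

theorem eq_weierstrass {f : Polynomial K} (hdeg : f.degree = (n : ℕ)) {x : Fin n → K}
    (hx : Function.Injective x) :
    f = C f.leadingCoeff *
      (∏ j, (X - C (x j)) + ∑ i, C (Wc f x i) * ∏ j ∈ univ.erase i, (X - C (x j))) := by
  have hf : f ≠ 0 := by rintro rfl; simp at hdeg
  have hlc : f.leadingCoeff ≠ 0 := leadingCoeff_ne_zero.2 hf
  have hdP : ∀ s : Finset (Fin n), (∏ j ∈ s, (X - C (x j))).degree = ((#s : ℕ) : WithBot ℕ) := fun s => by
    rw [degree_prod_of_monic _ _ fun j _ => monic_X_sub_C _]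
    simp
  have hmon : (∏ j, (X - C (x j))).Monic := monic_prod_X_sub_C _ _
  refine eq_of_degree_sub_lt_of_eval_index_eq (v := x) univ hx.injOn ?_ ?_
  · rw [mul_add, ← sub_sub]
    have hcard : (#(univ : Finset (Fin n))) = n := by simp
    rw [hcard]
    refine (degree_sub_le _ _).trans_lt (max_lt ?_ ?_)
    · rw [← hdeg]
      refine degree_sub_lt_left ?_ hf ?_
      · rw [degree_C_mul hlc, hdP, hdeg, hcard]
      · rw [leadingCoeff_mul, leadingCoeff_C, hmon.leadingCoeff, mul_one]
    · rw [degree_C_mul hlc]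
      refine (degree_sum_le _ _).trans_lt ((Finset.sup_lt_iff (WithBot.bot_lt_coe n)).2 ?_)
      intro i _
      rw [← smul_eq_C_mul]
      refine (degree_smul_le _ _).trans_lt ?_
      rw [hdP]
      have : #(univ.erase i) < #(univ : Finset (Fin n)) := card_erase_lt_of_mem (mem_univ i)
      rw [hcard] at this
      exact Nat.cast_lt.2 this
  · intro i _
    have hprod : ∏ j ∈ univ.erase i, (x i - x j) ≠ 0 :=
      prod_ne_zero_iff.2 fun j hj => sub_ne_zero.2 (hx.ne (ne_of_mem_erase hj).symm)
    have h0 : ∏ j, (x i - x j) = 0 := prod_eq_zero (mem_univ i) (sub_self _)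
    have h1 : ∑ k, Wc f x k * ∏ j ∈ univ.erase k, (x i - x j) =
        Wc f x i * ∏ j ∈ univ.erase i, (x i - x j) := by
      refine sum_eq_single i (fun k _ hk => ?_) (by simp)
      rw [prod_eq_zero (mem_erase.2 ⟨hk.symm, mem_univ i⟩) (sub_self _), mul_zero]
    simp only [eval_mul, eval_add, eval_C, eval_prod, eval_sub, eval_X, eval_finsetSum]
    rw [h0, h1, Wc, zero_add]
    field_simp

theorem sum_erase_div_dmin_le (hn : 2 ≤ n) {p q : ENNReal} [Fact (1 ≤ p)] (hpq : p⁻¹ + q⁻¹ = 1)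
    (f : Polynomial K) (x : Fin n → K) (i : Fin n) :
    ∑ j ∈ univ.erase i, ‖Wc f x j‖ / dmin x j ≤
      ((n : ℝ) - 1) ^ (q⁻¹).toReal * Ef p f x := by
  have h := sum_le_card_rpow_mul_norm (p := p) hpq _ (erase_nonempty hn i)
    (fun i => ‖Wc f x i‖ / dmin x i) fun i => div_nonneg (norm_nonneg _) (dmin_nonneg x i)
  rw [card_erase_of_mem (mem_univ i), card_univ, Fintype.card_fin,
    Nat.cast_sub (by omega), Nat.cast_one] at h
  exact h

theorem add_div_dmin_le {p q : ENNReal} [Fact (1 ≤ p)] (hpq : p⁻¹ + q⁻¹ = 1)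
    (f : Polynomial K) (x : Fin n → K) {i j : Fin n} (hij : i ≠ j) :
    ‖Wc f x i‖ / dmin x i + ‖Wc f x j‖ / dmin x j ≤ (2 : ℝ) ^ (q⁻¹).toReal * Ef p f x := by
  have h := sum_le_card_rpow_mul_norm (p := p) hpq {i, j} (insert_nonempty _ _)
    (fun i => ‖Wc f x i‖ / dmin x i) fun i => div_nonneg (norm_nonneg _) (dmin_nonneg x i)
  rw [sum_pair hij, card_pair hij] at h
  exact_mod_cast h

theorem div_dmin_le_Ef {p : ENNReal} [Fact (1 ≤ p)] (f : Polynomial K) (x : Fin n → K)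
    (i : Fin n) : ‖Wc f x i‖ / dmin x i ≤ Ef p f x :=
  (le_abs_self _).trans (PiLp.norm_apply_le (WithLp.toLp p fun i => ‖Wc f x i‖ / dmin x i) i)

theorem Wc_eq_of_correction {f : Polynomial K} (hdeg : f.degree = (n : ℕ)) {x y : Fin n → K}
    (hx : Function.Injective x) {i : Fin n} (hW : Wc f x i = -((y i - x i) * (1 + sigmaf f x i)))
    (hyx : ∀ j, j ≠ i → y i ≠ x j) :
    Wc f y i = -((y i - x i) ^ 2 * (∑ j ∈ univ.erase i, Wc f x j / ((y i - x j) * (x i - x j))) *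
      ∏ j ∈ univ.erase i, ((y i - x j) / (y i - y j))) := by
  have hf : f ≠ 0 := by rintro rfl; simp at hdeg
  have hlc : f.leadingCoeff ≠ 0 := leadingCoeff_ne_zero.2 hf
  have hsum : ∑ k ∈ univ.erase i, Wc f x k * ∏ j ∈ univ.erase k, (y i - x j) =
      (y i - x i) * (∏ j ∈ univ.erase i, (y i - x j)) *
        ∑ k ∈ univ.erase i, Wc f x k / (y i - x k) := by
    rw [mul_sum]
    refine sum_congr rfl fun k hk => ?_
    have hki := ne_of_mem_erase hk
    have hne := sub_ne_zero.2 (hyx k hki)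
    rw [← mul_prod_erase _ _ (mem_erase.2 ⟨hki.symm, mem_univ i⟩),
      ← mul_prod_erase _ _ (mem_erase.2 ⟨hki, mem_univ k⟩), erase_right_comm]
    field_simp
  have hdiff : ∑ k ∈ univ.erase i, Wc f x k / (y i - x k) - sigmaf f x i =
      -((y i - x i) * ∑ j ∈ univ.erase i, Wc f x j / ((y i - x j) * (x i - x j))) := by
    rw [sigmaf, ← sum_sub_distrib, mul_sum, ← sum_neg_distrib]
    refine sum_congr rfl fun k hk => ?_
    have hki := ne_of_mem_erase hk
    have hne := sub_ne_zero.2 (hyx k hki)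
    have hne' := sub_ne_zero.2 (hx.ne hki.symm)
    field_simp
    ring
  have heval : eval (y i) f = f.leadingCoeff * (-((y i - x i) ^ 2 *
      (∑ j ∈ univ.erase i, Wc f x j / ((y i - x j) * (x i - x j))) *
        ∏ j ∈ univ.erase i, (y i - x j))) := by
    have h := congrArg (eval (y i)) (eq_weierstrass hdeg hx)
    simp only [eval_mul, eval_add, eval_C, eval_prod, eval_sub, eval_X, eval_finsetSum] at h
    rw [← mul_prod_erase _ _ (mem_univ i), ← add_sum_erase _ _ (mem_univ i), hsum] at h
    rw [h, hW]
    congr 1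
    linear_combination (y i - x i) * (∏ j ∈ univ.erase i, (y i - x j)) * hdiff
  rw [Wc, heval, mul_div_mul_left _ _ hlc, prod_div_distrib]
  ring

/-- The bounds on the ratios `‖W_i(x)‖ / d_i(x)` that enter the analysis of one Ehrlich step. -/
structure RatioBounds (f : Polynomial K) (x : Fin n → K) (a b E : ℝ) : Prop where
  injective : Function.Injective x
  sum_le : ∀ i, ∑ j ∈ univ.erase i, ‖Wc f x j‖ / dmin x j ≤ a * E
  pair_le : ∀ i j, i ≠ j → ‖Wc f x i‖ / dmin x i + ‖Wc f x j‖ / dmin x j ≤ b * E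
  single_le : ∀ i, ‖Wc f x i‖ / dmin x i ≤ E
  nonneg : 0 ≤ E
  mul_lt_one : (a + b) * E < 1

namespace RatioBounds

variable {f : Polynomial K} {x : Fin n → K} {a b E : ℝ}

theorem norm_Wc_le (h : RatioBounds f x a b E) (hn : 2 ≤ n) {i j k : Fin n} {c : ℝ}
    (hc : ‖Wc f x k‖ / dmin x k ≤ c) (hij : i ≠ j) (hk : k = i ∨ k = j) :
    ‖Wc f x k‖ ≤ c * ‖x i - x j‖ := by
  have hd := dmin_pos hn h.injective k
  have hc0 : 0 ≤ c := (div_nonneg (norm_nonneg _) hd.le).trans hc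
  have hle : dmin x k ≤ ‖x i - x j‖ := by
    rcases hk with rfl | rfl
    · exact dmin_le x hij.symm
    · rw [norm_sub_rev]; exact dmin_le x hij
  calc ‖Wc f x k‖ ≤ c * dmin x k := (div_le_iff₀ hd).1 hc
    _ ≤ _ := by gcongr

theorem norm_sigmaf_le (h : RatioBounds f x a b E) (hn : 2 ≤ n) (i : Fin n) :
    ‖sigmaf f x i‖ ≤ a * E := by
  refine (norm_sum_le _ _).trans ((sum_le_sum fun j hj => ?_).trans (h.sum_le i))
  have hji := ne_of_mem_erase hj
  have hpos : 0 < ‖x i - x j‖ := norm_pos_iff.2 (sub_ne_zero.2 (h.injective.ne hji.symm))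
  rw [norm_div, div_le_iff₀ hpos]
  exact h.norm_Wc_le hn le_rfl hji.symm (Or.inr rfl)

theorem one_sub_le_norm (h : RatioBounds f x a b E) (hn : 2 ≤ n) (i : Fin n) :
    1 - a * E ≤ ‖1 + sigmaf f x i‖ := by
  have h1 := norm_sub_norm_le (1 : K) (-sigmaf f x i)
  rw [norm_one, norm_neg, sub_neg_eq_add] at h1
  linarith [h.norm_sigmaf_le hn i]

theorem one_sub_pos (h : RatioBounds f x a b E) (hb : 1 ≤ b) : 0 < 1 - a * E := by
  nlinarith [h.nonneg, h.mul_lt_one]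

theorem one_sub_succ_pos (h : RatioBounds f x a b E) (hb : 1 ≤ b) : 0 < 1 - (a + 1) * E := by
  nlinarith [h.nonneg, h.mul_lt_one]

theorem one_add_sigmaf_ne_zero (h : RatioBounds f x a b E) (hn : 2 ≤ n) (hb : 1 ≤ b)
    (i : Fin n) : 1 + sigmaf f x i ≠ 0 :=
  norm_pos_iff.1 ((h.one_sub_pos hb).trans_le (h.one_sub_le_norm hn i))

theorem norm_PhiE_sub_le (h : RatioBounds f x a b E) (hn : 2 ≤ n) (hb : 1 ≤ b) (i : Fin n) :
    ‖PhiE f x i - x i‖ ≤ ‖Wc f x i‖ / (1 - a * E) := by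
  have h1 := h.one_sub_pos hb
  have h2 := h.one_sub_le_norm hn i
  rw [PhiE, sub_sub_cancel_left, norm_neg, norm_div]
  gcongr

theorem le_norm_PhiE_sub (h : RatioBounds f x a b E) (hn : 2 ≤ n) (hb : 1 ≤ b) {i j : Fin n}
    (hij : i ≠ j) :
    (1 - (a + 1) * E) / (1 - a * E) * ‖x i - x j‖ ≤ ‖PhiE f x i - x j‖ := by
  have h1 := h.one_sub_pos hb
  have hW := h.norm_Wc_le hn (h.single_le i) hij (Or.inl rfl)
  have h3 := norm_sub_le (PhiE f x i - x j) (PhiE f x i - x i)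
  rw [sub_sub_sub_cancel_left] at h3
  calc (1 - (a + 1) * E) / (1 - a * E) * ‖x i - x j‖
      = ‖x i - x j‖ - E * ‖x i - x j‖ / (1 - a * E) := by field_simp; ring
    _ ≤ ‖x i - x j‖ - ‖Wc f x i‖ / (1 - a * E) := by gcongr
    _ ≤ _ := by linarith [h.norm_PhiE_sub_le hn hb i]

theorem le_norm_PhiE_sub_PhiE (h : RatioBounds f x a b E) (hn : 2 ≤ n) (hb : 1 ≤ b)
    {i j : Fin n} (hij : i ≠ j) :
    (1 - (a + b) * E) / (1 - a * E) * ‖x i - x j‖ ≤ ‖PhiE f x i - PhiE f x j‖ := by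
  have h1 := h.one_sub_pos hb
  have hWi := h.norm_Wc_le hn le_rfl hij (Or.inl rfl)
  have hWj := h.norm_Wc_le hn le_rfl hij (Or.inr rfl)
  have hW : ‖Wc f x i‖ + ‖Wc f x j‖ ≤ b * E * ‖x i - x j‖ :=
    calc _ ≤ _ := add_le_add hWi hWj
      _ = (‖Wc f x i‖ / dmin x i + ‖Wc f x j‖ / dmin x j) * ‖x i - x j‖ := by ring
      _ ≤ _ := by gcongr; exact h.pair_le i j hij
  have h3 : ‖x i - x j‖ ≤
      ‖PhiE f x i - PhiE f x j‖ + (‖PhiE f x i - x i‖ + ‖PhiE f x j - x j‖) := by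
    have h4 : x i - x j =
        (PhiE f x i - PhiE f x j) - ((PhiE f x i - x i) - (PhiE f x j - x j)) := by ring
    calc _ = _ := congrArg norm h4
      _ ≤ _ := (norm_sub_le _ _).trans (by gcongr; exact norm_sub_le _ _)
  calc (1 - (a + b) * E) / (1 - a * E) * ‖x i - x j‖
      = ‖x i - x j‖ - b * E * ‖x i - x j‖ / (1 - a * E) := by field_simp; ring
    _ ≤ ‖x i - x j‖ - (‖Wc f x i‖ + ‖Wc f x j‖) / (1 - a * E) := by gcongr
    _ ≤ _ := by
      rw [add_div]
      linarith [h.norm_PhiE_sub_le hn hb i, h.norm_PhiE_sub_le hn hb j]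

theorem ratio_pos (h : RatioBounds f x a b E) (hb : 1 ≤ b) :
    0 < (1 - (a + b) * E) / (1 - a * E) :=
  div_pos (sub_pos.2 h.mul_lt_one) (h.one_sub_pos hb)

theorem PhiE_injective (h : RatioBounds f x a b E) (hn : 2 ≤ n) (hb : 1 ≤ b) :
    Function.Injective (PhiE f x) := by
  intro i j hij
  by_contra hne
  have h1 := h.le_norm_PhiE_sub_PhiE hn hb hne
  rw [hij, sub_self, norm_zero] at h1
  exact h1.not_gt (mul_pos (h.ratio_pos hb)
    (norm_pos_iff.2 (sub_ne_zero.2 (h.injective.ne hne))))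

theorem le_dmin_PhiE (h : RatioBounds f x a b E) (hn : 2 ≤ n) (hb : 1 ≤ b) (i : Fin n) :
    (1 - (a + b) * E) / (1 - a * E) * dmin x i ≤ dmin (PhiE f x) i :=
  le_dmin hn _ _ fun _ hj => (mul_le_mul_of_nonneg_left (dmin_le x hj) (h.ratio_pos hb).le).trans
    (h.le_norm_PhiE_sub_PhiE hn hb hj.symm)

theorem norm_sum_div_le (h : RatioBounds f x a b E) (hn : 2 ≤ n) (hb : 1 ≤ b) (i : Fin n) :
    ‖∑ j ∈ univ.erase i, Wc f x j / ((PhiE f x i - x j) * (x i - x j))‖ ≤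
      a * E * ((1 - a * E) / ((1 - (a + 1) * E) * dmin x i)) := by
  have h1 := h.one_sub_pos hb
  have h2 := h.one_sub_succ_pos hb
  have hd := dmin_pos hn h.injective i
  calc _ ≤ ∑ j ∈ univ.erase i, ‖Wc f x j‖ / dmin x j *
        ((1 - a * E) / ((1 - (a + 1) * E) * dmin x i)) := by
        refine (norm_sum_le _ _).trans (sum_le_sum fun j hj => ?_)
        have hji := ne_of_mem_erase hj
        have hpos : 0 < ‖x i - x j‖ :=
          norm_pos_iff.2 (sub_ne_zero.2 (h.injective.ne hji.symm))
        have hdj := dmin_pos hn h.injective j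
        have h3 : (1 - (a + 1) * E) / (1 - a * E) * dmin x i ≤ ‖PhiE f x i - x j‖ :=
          (mul_le_mul_of_nonneg_left (dmin_le x hji) (div_pos h2 h1).le).trans
            (h.le_norm_PhiE_sub hn hb hji.symm)
        have h4 : dmin x j ≤ ‖x i - x j‖ := by
          rw [norm_sub_rev]; exact dmin_le x hji.symm
        rw [norm_div, norm_mul]
        calc ‖Wc f x j‖ / (‖PhiE f x i - x j‖ * ‖x i - x j‖)
            ≤ ‖Wc f x j‖ / ((1 - (a + 1) * E) / (1 - a * E) * dmin x i * dmin x j) := by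
              gcongr
          _ = _ := by field_simp
    _ ≤ _ := by
        rw [← sum_mul]
        gcongr
        exact h.sum_le i

theorem norm_prod_div_le (h : RatioBounds f x a b E) (hn : 2 ≤ n) (hb : 1 ≤ b) (i : Fin n) :
    ‖∏ j ∈ univ.erase i, ((PhiE f x i - x j) / (PhiE f x i - PhiE f x j))‖ ≤
      (1 + a * E / (((n : ℝ) - 1) * (1 - (a + b) * E))) ^ (n - 1) := by
  have h1 := h.one_sub_pos hb
  have h2 : 0 < 1 - (a + b) * E := sub_pos.2 h.mul_lt_one
  have hcard : #(univ.erase i) = n - 1 := by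
    rw [card_erase_of_mem (mem_univ i), card_univ, Fintype.card_fin]
  have hn1 : ((n - 1 : ℕ) : ℝ) = (n : ℝ) - 1 := by
    rw [Nat.cast_sub (by omega), Nat.cast_one]
  have hn0 : (0 : ℝ) < (n : ℝ) - 1 := by
    rw [← hn1]; exact_mod_cast (by omega : 0 < n - 1)
  have hu : ∀ j, 0 ≤ ‖Wc f x j‖ / dmin x j := fun j =>
    div_nonneg (norm_nonneg _) (dmin_nonneg x j)
  calc _ ≤ ∏ j ∈ univ.erase i, (1 + ‖Wc f x j‖ / dmin x j / (1 - (a + b) * E)) := by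
        rw [norm_prod]
        refine prod_le_prod (fun _ _ => norm_nonneg _) fun j hj => ?_
        have hij := (ne_of_mem_erase hj).symm
        have hpos : 0 < ‖x i - x j‖ := norm_pos_iff.2 (sub_ne_zero.2 (h.injective.ne hij))
        have hne : PhiE f x i - PhiE f x j ≠ 0 :=
          sub_ne_zero.2 ((h.PhiE_injective hn hb).ne hij)
        have heq : (PhiE f x i - x j) / (PhiE f x i - PhiE f x j) =
            1 + (PhiE f x j - x j) / (PhiE f x i - PhiE f x j) := by
          field_simp; ring
        have hlow := h.le_norm_PhiE_sub_PhiE hn hb hij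
        have hratio := h.ratio_pos hb
        have hup := h.norm_PhiE_sub_le hn hb j
        have hW := h.norm_Wc_le hn le_rfl hij (Or.inr rfl)
        rw [heq]
        refine (norm_add_le _ _).trans ?_
        rw [norm_one, norm_div]
        refine add_le_add le_rfl ?_
        calc ‖PhiE f x j - x j‖ / ‖PhiE f x i - PhiE f x j‖
            ≤ (‖Wc f x j‖ / dmin x j * ‖x i - x j‖ / (1 - a * E)) /
              ((1 - (a + b) * E) / (1 - a * E) * ‖x i - x j‖) := by
              have := hu j
              exact div_le_div₀ (by positivity) (hup.trans (by gcongr)) (by positivity) hlow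
          _ = _ := by
              generalize ‖Wc f x j‖ / dmin x j = u
              field_simp
    _ ≤ (1 + (∑ j ∈ univ.erase i, ‖Wc f x j‖ / dmin x j / (1 - (a + b) * E)) /
          #(univ.erase i)) ^ #(univ.erase i) :=
        prod_one_add_le_pow _ _ fun j _ => div_nonneg (hu j) h2.le
    _ ≤ _ := by
        rw [hcard, hn1, ← sum_div, div_div, mul_comm (1 - (a + b) * E)]
        have hs : 0 ≤ ∑ j ∈ univ.erase i, ‖Wc f x j‖ / dmin x j := sum_nonneg fun j _ => hu j
        gcongr
        exact h.sum_le i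

theorem norm_Wc_PhiE_le (h : RatioBounds f x a b E) (hn : 2 ≤ n) (hb : 1 ≤ b) (ha : 0 ≤ a)
    (hdeg : f.degree = (n : ℕ)) (i : Fin n) :
    ‖Wc f (PhiE f x) i‖ ≤ a * E ^ 2 / ((1 - a * E) * (1 - (a + 1) * E)) *
      (1 + a * E / (((n : ℝ) - 1) * (1 - (a + b) * E))) ^ (n - 1) * ‖Wc f x i‖ := by
  have h1 := h.one_sub_pos hb
  have h2 := h.one_sub_succ_pos hb
  have h3 := h.nonneg
  have hd := dmin_pos hn h.injective i
  have hne := h.one_add_sigmaf_ne_zero hn hb i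
  have hW : Wc f x i = -((PhiE f x i - x i) * (1 + sigmaf f x i)) := by
    rw [PhiE]; field_simp; ring
  have hyx : ∀ j, j ≠ i → PhiE f x i ≠ x j := fun j hj => by
    refine sub_ne_zero.1 (norm_pos_iff.1 (lt_of_lt_of_le ?_ (h.le_norm_PhiE_sub hn hb hj.symm)))
    exact mul_pos (div_pos h2 h1) (norm_pos_iff.2 (sub_ne_zero.2 (h.injective.ne hj.symm)))
  rw [Wc_eq_of_correction hdeg h.injective hW hyx, norm_neg, norm_mul, norm_mul, norm_pow]
  calc _ ≤ (‖Wc f x i‖ / (1 - a * E)) ^ 2 *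
        (a * E * ((1 - a * E) / ((1 - (a + 1) * E) * dmin x i))) *
        (1 + a * E / (((n : ℝ) - 1) * (1 - (a + b) * E))) ^ (n - 1) := by
        gcongr
        · exact h.norm_PhiE_sub_le hn hb i
        · exact h.norm_sum_div_le hn hb i
        · exact h.norm_prod_div_le hn hb i
    _ = (‖Wc f x i‖ / dmin x i) * (a * E / ((1 - a * E) * (1 - (a + 1) * E)) * ‖Wc f x i‖ *
        (1 + a * E / (((n : ℝ) - 1) * (1 - (a + b) * E))) ^ (n - 1)) := by
        field_simp
    _ ≤ E * (a * E / ((1 - a * E) * (1 - (a + 1) * E)) * ‖Wc f x i‖ *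
        (1 + a * E / (((n : ℝ) - 1) * (1 - (a + b) * E))) ^ (n - 1)) := by
        refine mul_le_mul_of_nonneg_right (h.single_le i) ?_
        have := (norm_nonneg _).trans (h.norm_prod_div_le hn hb i)
        positivity
    _ = _ := by ring

end RatioBounds

theorem ratioBounds_of_Ef_le (hn : 2 ≤ n) {p q : ENNReal} [Fact (1 ≤ p)] (hpq : p⁻¹ + q⁻¹ = 1)
    {f : Polynomial K} {x : Fin n → K} (hx : Function.Injective x) {a b E : ℝ}
    (ha : a = ((n : ℝ) - 1) ^ (ENNReal.toReal q⁻¹)) (hb : b = (2 : ℝ) ^ (ENNReal.toReal q⁻¹))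
    (ha0 : 0 ≤ a) (hE : Ef p f x ≤ E) (hab : (a + b) * E < 1) : RatioBounds f x a b E where
  injective := hx
  sum_le i := (sum_erase_div_dmin_le hn hpq f x i).trans (by rw [← ha]; gcongr)
  pair_le i j hij := (add_div_dmin_le hpq f x hij).trans (by rw [hb]; gcongr)
  single_le i := (div_dmin_le_Ef f x i).trans hE
  nonneg := (norm_nonneg _).trans hE
  mul_lt_one := hab

/-- The contraction factor of the Weierstrass corrections in one Ehrlich step. -/
def ehrlichBeta (n : ℕ) (a b t : ℝ) : ℝ :=
  a * t ^ 2 / ((1 - a * t) * (1 - (a + 1) * t)) *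
    (1 + a * t / (((n : ℝ) - 1) * (1 - (a + b) * t))) ^ (n - 1)

/-- The contraction factor of `E_f` in one Ehrlich step. -/
def ehrlichPhi (n : ℕ) (a b t : ℝ) : ℝ :=
  a * t ^ 2 / ((1 - (a + 1) * t) * (1 - (a + b) * t)) *
    (1 + a * t / (((n : ℝ) - 1) * (1 - (a + b) * t))) ^ (n - 1)

section Scalar

variable {a b t : ℝ}

theorem one_sub_bounds (hb : 1 ≤ b) (ht : 0 ≤ t) (hab : (a + b) * t < 1) :
    0 < 1 - a * t ∧ 0 < 1 - (a + 1) * t ∧ 0 < 1 - (a + b) * t := by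
  refine ⟨?_, ?_, ?_⟩ <;> nlinarith

theorem ehrlichBeta_eq (hb : 1 ≤ b) (ht : 0 ≤ t) (hab : (a + b) * t < 1) :
    ehrlichBeta n a b t = (1 - (a + b) * t) / (1 - a * t) * ehrlichPhi n a b t := by
  obtain ⟨h1, h2, h3⟩ := one_sub_bounds hb ht hab
  rw [ehrlichBeta, ehrlichPhi, ← mul_assoc]
  congr 1
  rw [div_mul_div_comm, div_eq_div_iff (by positivity) (by positivity)]
  ring

theorem ehrlichPhi_nonneg (hn : 2 ≤ n) (ha : 0 ≤ a) (hb : 1 ≤ b) (ht : 0 ≤ t)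
    (hab : (a + b) * t < 1) : 0 ≤ ehrlichPhi n a b t := by
  obtain ⟨h1, h2, h3⟩ := one_sub_bounds hb ht hab
  have hn0 : (0 : ℝ) < (n : ℝ) - 1 := by
    have : (2 : ℝ) ≤ n := by exact_mod_cast hn
    linarith
  unfold ehrlichPhi
  positivity

theorem ehrlichPhi_mul_le (hn : 2 ≤ n) (ha : 0 ≤ a) (hb : 1 ≤ b) (ht : 0 ≤ t)
    (hab : (a + b) * t < 1) {s : ℝ} (hs : 0 ≤ s) (hs1 : s ≤ 1) :
    ehrlichPhi n a b (t * s) ≤ s ^ 2 * ehrlichPhi n a b t := by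
  obtain ⟨h1, h2, h3⟩ := one_sub_bounds hb ht hab
  have hle : t * s ≤ t := mul_le_of_le_one_right ht hs1
  have hts : 0 ≤ t * s := mul_nonneg ht hs
  have hn0 : (0 : ℝ) < (n : ℝ) - 1 := by
    have : (2 : ℝ) ≤ n := by exact_mod_cast hn
    linarith
  have g2 : 0 < 1 - (a + 1) * (t * s) := h2.trans_le (by gcongr)
  have g3 : 0 < 1 - (a + b) * (t * s) := h3.trans_le (by gcongr)
  unfold ehrlichPhi
  calc _ ≤ a * (t * s) ^ 2 / ((1 - (a + 1) * t) * (1 - (a + b) * t)) *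
        (1 + a * t / (((n : ℝ) - 1) * (1 - (a + b) * t))) ^ (n - 1) := by gcongr
    _ = _ := by ring

theorem ehrlichBeta_mul_le (hn : 2 ≤ n) (ha : 0 ≤ a) (hb : 1 ≤ b) (ht : 0 ≤ t)
    (hab : (a + b) * t < 1) {s : ℝ} (hs : 0 ≤ s) (hs1 : s ≤ 1) :
    ehrlichBeta n a b (t * s) ≤ s ^ 2 * ehrlichBeta n a b t := by
  obtain ⟨h1, h2, h3⟩ := one_sub_bounds hb ht hab
  have hle : t * s ≤ t := mul_le_of_le_one_right ht hs1
  have hts : 0 ≤ t * s := mul_nonneg ht hs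
  have hn0 : (0 : ℝ) < (n : ℝ) - 1 := by
    have : (2 : ℝ) ≤ n := by exact_mod_cast hn
    linarith
  have g1 : 0 < 1 - a * (t * s) := h1.trans_le (by gcongr)
  have g2 : 0 < 1 - (a + 1) * (t * s) := h2.trans_le (by gcongr)
  have g3 : 0 < 1 - (a + b) * (t * s) := h3.trans_le (by gcongr)
  unfold ehrlichBeta
  calc _ ≤ a * (t * s) ^ 2 / ((1 - a * t) * (1 - (a + 1) * t)) *
        (1 + a * t / (((n : ℝ) - 1) * (1 - (a + b) * t))) ^ (n - 1) := by gcongr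
    _ = _ := by ring

end Scalar

theorem RatioBounds.Ef_PhiE_le {f : Polynomial K} {x : Fin n → K} {a b E : ℝ}
    (h : RatioBounds f x a b E) (hn : 2 ≤ n) (hb : 1 ≤ b) (ha : 0 ≤ a)
    (hdeg : f.degree = (n : ℕ)) {p : ENNReal} [Fact (1 ≤ p)] :
    Ef p f (PhiE f x) ≤ ehrlichPhi n a b E * Ef p f x := by
  refine norm_toLp_le_mul (ehrlichPhi_nonneg hn ha hb h.nonneg h.mul_lt_one) _ _
    (fun i => div_nonneg (norm_nonneg _) (dmin_nonneg _ i)) fun i => ?_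
  have hd := dmin_pos hn h.injective i
  have hψ := h.ratio_pos hb
  have hW := h.norm_Wc_PhiE_le hn hb ha hdeg i
  rw [← ehrlichBeta, ehrlichBeta_eq hb h.nonneg h.mul_lt_one] at hW
  calc ‖Wc f (PhiE f x) i‖ / dmin (PhiE f x) i
      ≤ ((1 - (a + b) * E) / (1 - a * E) * ehrlichPhi n a b E * ‖Wc f x i‖) /
        ((1 - (a + b) * E) / (1 - a * E) * dmin x i) :=
        div_le_div₀ ((norm_nonneg _).trans hW) hW (by positivity) (h.le_dmin_PhiE hn hb i)
    _ = ehrlichPhi n a b E * (‖Wc f x i‖ / dmin x i) := by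
        rw [mul_assoc, mul_div_mul_left _ _ hψ.ne', mul_div_assoc]

theorem tendsto_coeff_prod_X_sub_C {ι : Type*} {x : ℕ → ι → K} {ξ : ι → K}
    (h : ∀ j, Tendsto (fun k => x k j) atTop (nhds (ξ j))) (s : Finset ι) (m : ℕ) :
    Tendsto (fun k => (∏ j ∈ s, (X - C (x k j))).coeff m) atTop
      (nhds ((∏ j ∈ s, (X - C (ξ j))).coeff m)) := by
  classical
  induction s using Finset.induction_on generalizing m with
  | empty => simp
  | insert i s hi ih =>
    simp only [prod_insert hi, coeff_mul]
    refine tendsto_finsetSum _ fun c _ => Tendsto.mul ?_ (ih _)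
    simp only [coeff_sub, coeff_C]
    split_ifs
    · exact tendsto_const_nhds.sub (h i)
    · exact tendsto_const_nhds

theorem isRootVector_of_tendsto {f : Polynomial K} (hdeg : f.degree = (n : ℕ))
    {x : ℕ → Fin n → K} {ξ : Fin n → K} (hx : ∀ k, Function.Injective (x k))
    (hlim : ∀ j, Tendsto (fun k => x k j) atTop (nhds (ξ j)))
    (hW : ∀ j, Tendsto (fun k => Wc f (x k) j) atTop (nhds 0)) : IsRootVector f ξ := by
  ext m
  have h : ∀ k, f.coeff m = f.leadingCoeff * ((∏ j, (X - C (x k j))).coeff m +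
      ∑ i, Wc f (x k) i * (∏ j ∈ univ.erase i, (X - C (x k j))).coeff m) := fun k => by
    have := congrArg (fun P => P.coeff m) (eq_weierstrass hdeg (hx k))
    simpa only [coeff_C_mul, coeff_add, finsetSum_coeff] using this
  have ht := ((tendsto_coeff_prod_X_sub_C hlim univ m).add (tendsto_finsetSum univ fun i _ =>
    (hW i).mul (tendsto_coeff_prod_X_sub_C hlim (univ.erase i) m))).const_mul f.leadingCoeff
  simp only [← h, zero_mul, sum_const_zero, add_zero] at ht
  rw [coeff_C_mul]
  exact tendsto_nhds_unique tendsto_const_nhds ht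

end Weierstrass

theorem dist_le_of_dist_le_geometric {α : Type*} [PseudoMetricSpace α] {r D : ℝ} (hr0 : 0 ≤ r)
    (hr : r < 1) (hD : 0 ≤ D) {u : ℕ → α} (h : ∀ k, dist (u k) (u (k + 1)) ≤ D * r ^ k) (k : ℕ) :
    dist (u 0) (u k) ≤ D / (1 - r) := by
  refine (dist_le_range_sum_of_dist_le k fun {j} _ => h j).trans ?_
  rw [← mul_sum, div_eq_mul_inv, ← tsum_geometric_of_lt_one hr0 hr]
  gcongr
  exact (summable_geometric_of_lt_one hr0 hr).sum_le_tsum _ fun _ _ => by positivity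

theorem exists_two_mul_add_one_eq_pow (k : ℕ) : 2 * ((3 ^ k - 1) / 2) + 1 = 3 ^ k := by
  have h : Odd (3 ^ k) := Odd.pow (by decide)
  obtain ⟨m, hm⟩ := h
  omega

theorem rpow_three_pow_sub_one_div_two (c : ℝ) (k : ℕ) :
    c ^ (((3 : ℝ) ^ k - 1) / 2) = c ^ ((3 ^ k - 1) / 2) := by
  have h : ((3 : ℝ) ^ k - 1) / 2 = (((3 ^ k - 1) / 2 : ℕ) : ℝ) := by
    have := exists_two_mul_add_one_eq_pow k
    have : (2 : ℝ) * (((3 ^ k - 1) / 2 : ℕ) : ℝ) + 1 = 3 ^ k := by exact_mod_cast this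
    linarith
  rw [h, Real.rpow_natCast]

/-- Proinov, Theorem 3.4 (i),(ii): semilocal convergence of Ehrlich's method. -/
theorem stmt_12 {n : ℕ} {K : Type*} [NormedField K] [CompleteSpace K] (hn : 2 ≤ n)
    (f : Polynomial K) (hdeg : f.degree = (n : ℕ))
    (p q : ENNReal) (hp : 1 ≤ p) (hpq : p⁻¹ + q⁻¹ = 1)
    (a b : ℝ) (ha : a = ((n : ℝ) - 1) ^ (ENNReal.toReal q⁻¹))
    (hb : b = (2 : ℝ) ^ (ENNReal.toReal q⁻¹))
    (γ β φ : ℝ → ℝ)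
    (hγ : ∀ t, γ t = 1 / (1 - a * t))
    (hβ : ∀ t, β t = a * t ^ 2 / ((1 - a * t) * (1 - (a + 1) * t)) *
      (1 + a * t / (((n : ℝ) - 1) * (1 - (a + b) * t))) ^ (n - 1))
    (hφ : ∀ t, φ t = a * t ^ 2 / ((1 - (a + 1) * t) * (1 - (a + b) * t)) *
      (1 + a * t / (((n : ℝ) - 1) * (1 - (a + b) * t))) ^ (n - 1))
    (x0 : Fin n → K) (hx0 : Function.Injective x0)
    (hE0 : Ef p f x0 < 1 / (a + b)) (hφ1 : φ (Ef p f x0) ≤ 1)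
    (lam θ : ℝ) (hlam : lam = φ (Ef p f x0))
    (hθ : θ = (1 - (a + b) * Ef p f x0) / (1 - a * Ef p f x0)) :
    (∀ k : ℕ, Function.Injective ((PhiE f)^[k] x0) ∧
      ∀ i : Fin n, (1 : K) + sigmaf f ((PhiE f)^[k] x0) i ≠ 0) ∧
    (∀ k : ℕ, ∀ i, ‖(PhiE f)^[k] x0 i - x0 i‖ ≤
      γ (Ef p f x0) / (1 - β (Ef p f x0)) * ‖Wc f x0 i‖) ∧
    ∃ ξ : Fin n → K, IsRootVector f ξ ∧
      Tendsto (fun k => (PhiE f)^[k] x0) atTop (nhds ξ) ∧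
      ∀ k : ℕ, ∀ i, ‖(PhiE f)^[k] x0 i - ξ i‖ ≤
        γ (Ef p f x0 * lam ^ (((3 : ℝ) ^ k - 1) / 2)) *
          (θ ^ k * lam ^ (((3 : ℝ) ^ k - 1) / 2) / (1 - θ * lam ^ ((3 : ℝ) ^ k))) *
          ‖Wc f x0 i‖ := by
  have : Fact (1 ≤ p) := ⟨hp⟩
  obtain rfl : φ = ehrlichPhi n a b := funext hφ
  obtain rfl : β = ehrlichBeta n a b := funext hβ
  have hn1 : (1 : ℝ) ≤ (n : ℝ) - 1 := by
    have : (2 : ℝ) ≤ n := by exact_mod_cast hn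
    linarith
  have ha0 : 0 ≤ a := ha ▸ Real.rpow_nonneg (by linarith) _
  have hb1 : 1 ≤ b := hb ▸ Real.one_le_rpow one_le_two ENNReal.toReal_nonneg
  have hab : (a + b) * Ef p f x0 < 1 := by
    rw [lt_div_iff₀ (by linarith)] at hE0
    linarith
  have hE : 0 ≤ Ef p f x0 := norm_nonneg _
  have hlam0 : 0 ≤ lam := hlam ▸ ehrlichPhi_nonneg hn ha0 hb1 hE hab
  have hlam1 : lam ≤ 1 := hlam ▸ hφ1
  obtain ⟨hg1, -, hg3⟩ := one_sub_bounds hb1 hE hab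
  have hθ0 : 0 < θ := hθ ▸ div_pos hg3 hg1
  have hβE : ehrlichBeta n a b (Ef p f x0) = θ * lam := by
    rw [ehrlichBeta_eq hb1 hE hab, hθ, hlam]
  have hβ1 : θ * lam < 1 := by
    rcases hE.eq_or_lt with h0 | h0
    · rw [← hβE, ← h0]; simp [ehrlichBeta]
    · have : θ < 1 := by
        rw [hθ, div_lt_one hg1]
        nlinarith
      nlinarith
  set E := Ef p f x0
  set x : ℕ → Fin n → K := fun k => (PhiE f)^[k] x0 with hxdef
  have hxs : ∀ k, x (k + 1) = PhiE f (x k) := fun k => Function.iterate_succ_apply' _ _ _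
  set m : ℕ → ℕ := fun k => (3 ^ k - 1) / 2 with hm
  have hm3 : ∀ k, 2 * m k + 1 = 3 ^ k := exists_two_mul_add_one_eq_pow
  have hms : ∀ k, m (k + 1) = m k + 3 ^ k := fun k => by
    have h1 := hm3 k
    have h2 := hm3 (k + 1)
    rw [pow_succ] at h2
    omega
  have hmmono : Monotone m := monotone_nat_of_le_succ fun k => (hms k).symm ▸ Nat.le_add_right _ _
  have hpow1 : ∀ j : ℕ, lam ^ j ≤ 1 := fun j => pow_le_one₀ hlam0 hlam1
  have heab : ∀ k, (a + b) * (E * lam ^ m k) < 1 := fun k => by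
    refine lt_of_le_of_lt ?_ hab
    gcongr
    exact mul_le_of_le_one_right hE (hpow1 _)
  have key : ∀ k, Function.Injective (x k) ∧ Ef p f (x k) ≤ E * lam ^ m k := fun k => by
    induction k with
    | zero => exact ⟨hx0, by simp [hm, hxdef, E]⟩
    | succ k ih =>
      have hR := ratioBounds_of_Ef_le hn hpq ih.1 ha hb ha0 ih.2 (heab k)
      rw [hxs]
      refine ⟨hR.PhiE_injective hn hb1, (hR.Ef_PhiE_le hn hb1 ha0 hdeg).trans ?_⟩
      calc _ ≤ ((lam ^ m k) ^ 2 * lam) * (E * lam ^ m k) := by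
            refine mul_le_mul ?_ ih.2 (norm_nonneg _) (by positivity)
            rw [hlam]
            rw [hlam] at hlam0 hpow1
            exact ehrlichPhi_mul_le hn ha0 hb1 hE hab (by positivity) (hpow1 _)
        _ = _ := by rw [hms, ← hm3 k]; ring
  have hR : ∀ k, RatioBounds f (x k) a b (E * lam ^ m k) := fun k =>
    ratioBounds_of_Ef_le hn hpq (key k).1 ha hb ha0 (key k).2 (heab k)
  have hWs : ∀ k i, ‖Wc f (x (k + 1)) i‖ ≤ θ * lam ^ 3 ^ k * ‖Wc f (x k) i‖ := fun k i => by
    rw [hxs]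
    refine ((hR k).norm_Wc_PhiE_le hn hb1 ha0 hdeg i).trans ?_
    rw [← ehrlichBeta]
    gcongr
    refine (ehrlichBeta_mul_le hn ha0 hb1 hE hab (by positivity) (hpow1 _)).trans_eq ?_
    rw [hβE, ← hm3 k]
    ring
  have hW0 : ∀ k i, ‖Wc f (x k) i‖ ≤ θ ^ k * lam ^ m k * ‖Wc f x0 i‖ := fun k i => by
    induction k with
    | zero => simp [hm, hxdef]
    | succ k ih =>
      calc _ ≤ θ * lam ^ 3 ^ k * (θ ^ k * lam ^ m k * ‖Wc f x0 i‖) :=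
            (hWs k i).trans (by gcongr)
        _ = _ := by rw [hms]; ring
  have hWj : ∀ k j i, ‖Wc f (x (k + j)) i‖ ≤ (θ * lam ^ 3 ^ k) ^ j * ‖Wc f (x k) i‖ :=
    fun k j i => by
    induction j with
    | zero => simp
    | succ j ih =>
      calc _ ≤ θ * lam ^ 3 ^ (k + j) * ((θ * lam ^ 3 ^ k) ^ j * ‖Wc f (x k) i‖) :=
            (hWs (k + j) i).trans (by gcongr)
        _ ≤ θ * lam ^ 3 ^ k * ((θ * lam ^ 3 ^ k) ^ j * ‖Wc f (x k) i‖) := by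
            gcongr θ * ?_ * _
            exact pow_le_pow_of_le_one hlam0 hlam1 (Nat.pow_le_pow_right (by norm_num) (by omega))
        _ = _ := by ring
  have hr1 : ∀ k, θ * lam ^ 3 ^ k < 1 := fun k => by
    refine lt_of_le_of_lt ?_ hβ1
    gcongr
    exact pow_le_of_le_one hlam0 hlam1 (by positivity)
  have hstep : ∀ k i j, dist (x (k + j) i) (x (k + (j + 1)) i) ≤
      1 / (1 - a * (E * lam ^ m k)) * ‖Wc f (x k) i‖ * (θ * lam ^ 3 ^ k) ^ j := fun k i j => by
    rw [dist_comm, dist_eq_norm, ← add_assoc, hxs]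
    have h1 := (hR k).one_sub_pos hb1
    calc _ ≤ ‖Wc f (x (k + j)) i‖ / (1 - a * (E * lam ^ m (k + j))) :=
          (hR (k + j)).norm_PhiE_sub_le hn hb1 i
      _ ≤ (θ * lam ^ 3 ^ k) ^ j * ‖Wc f (x k) i‖ / (1 - a * (E * lam ^ m k)) := by
          gcongr ?_ / (1 - a * (E * ?_))
          · exact hWj k j i
          · exact pow_le_pow_of_le_one hlam0 hlam1 (hmmono (by omega))
      _ = _ := by ring
  have hstep0 : ∀ i j, dist (x j i) (x (j + 1) i) ≤
      1 / (1 - a * E) * ‖Wc f x0 i‖ * (θ * lam) ^ j := fun i j => by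
    simpa [hm, hxdef] using hstep 0 i j
  have hlim : ∀ i, ∃ z, Tendsto (fun k => x k i) atTop (nhds z) := fun i =>
    cauchySeq_tendsto_of_complete (cauchySeq_of_le_geometric _ _ hβ1 (hstep0 i))
  choose ξ hξ using hlim
  refine ⟨fun k => ⟨(key k).1, (hR k).one_add_sigmaf_ne_zero hn hb1⟩, fun k i => ?_, ξ, ?_,
    tendsto_pi_nhds.2 hξ, fun k i => ?_⟩
  · rw [← dist_eq_norm, dist_comm, hβE, hγ, div_mul_eq_mul_div]
    exact dist_le_of_dist_le_geometric (u := fun k => x k i) (by positivity) hβ1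
      (by positivity) (hstep0 i) k
  · refine isRootVector_of_tendsto hdeg (fun k => (key k).1) hξ fun i => ?_
    refine squeeze_zero_norm (a := fun k => (θ * lam) ^ k * ‖Wc f x0 i‖) (fun k => ?_) ?_
    · simpa [hxdef] using hWj 0 k i
    · simpa using (tendsto_pow_atTop_nhds_zero_of_lt_one (by positivity) hβ1).mul_const
        ‖Wc f x0 i‖
  · have h3 : lam ^ ((3 : ℝ) ^ k) = lam ^ 3 ^ k := by
      rw [← Real.rpow_natCast lam (3 ^ k), Nat.cast_pow, Nat.cast_ofNat]
    have h1 := (hR k).one_sub_pos hb1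
    have h2 := sub_pos.2 (hr1 k)
    rw [rpow_three_pow_sub_one_div_two, h3, hγ, ← dist_eq_norm]
    have hlimk : Tendsto (fun j => x (k + j) i) atTop (nhds (ξ i)) := by
      simpa only [add_comm k] using (tendsto_add_atTop_iff_nat k).2 (hξ i)
    calc dist (x k i) (ξ i)
        ≤ 1 / (1 - a * (E * lam ^ m k)) * ‖Wc f (x k) i‖ / (1 - θ * lam ^ 3 ^ k) :=
          dist_le_of_le_geometric_of_tendsto₀ _ _ (hr1 k) (hstep k i) hlimk
      _ ≤ 1 / (1 - a * (E * lam ^ m k)) * (θ ^ k * lam ^ m k * ‖Wc f x0 i‖) /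
          (1 - θ * lam ^ 3 ^ k) := by
          gcongr
          exact hW0 k i
      _ = _ := by ring
end
end

section
/- For every x ∈ 𝒟, the Dochev-Byrnev iteration function equals the Prešić-Tanabe iteration function: ℱ(x) = 𝒯(x), i.e. for every i, x_i − (f(x_i)/g'(x_i))·(2 − f'(x_i)/g'(x_i) + (1/2)·(f(x_i)/g'(x_i))·(g''(x_i)/g'(x_i))) = x_i − W_i(x)·(1 − Σ_{j≠i} W_j(x)/(x_i − x_j)), where g(z) = C₀ ∏_{j=1}^n (z − x_j). (Theorem 4.1) -/
open Finset Polynomial Filter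

noncomputable section

/-- The Lagrange interpolation formula for a polynomial of degree `n`, expressed through its
Weierstrass corrections. -/
theorem eq_nodal_add_sum_Wc {n : ℕ} {K : Type*} [NormedField K] {f : K[X]}
    (hdeg : f.degree = (n : ℕ)) {x : Fin n → K} (hx : Function.Injective x) :
    f = C f.leadingCoeff * ∏ j, (X - C (x j)) +
      ∑ j, C (f.leadingCoeff * Wc f x j) * ∏ k ∈ univ.erase j, (X - C (x k)) := by
  have hf : f ≠ 0 := by
    rintro rfl
    simp at hdeg
  have hc : f.leadingCoeff ≠ 0 := leadingCoeff_ne_zero.mpr hf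
  have hmon : (∏ j, (X - C (x j))).Monic := monic_prod_of_monic _ _ fun j _ => monic_X_sub_C _
  have hgdeg : (C f.leadingCoeff * ∏ j, (X - C (x j))).degree = n := by
    rw [degree_C_mul hc, degree_prod]
    simp
  rw [← sub_eq_iff_eq_add']
  refine eq_of_degrees_lt_of_eval_index_eq (s := univ) (v := x) hx.injOn ?_ ?_ ?_
  · rw [card_univ, Fintype.card_fin, ← hdeg]
    refine degree_sub_lt_left (hdeg.trans hgdeg.symm) hf ?_
    rw [leadingCoeff_mul, leadingCoeff_C, hmon.leadingCoeff, mul_one]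
  · refine (degree_sum_le _ _).trans_lt ((Finset.sup_lt_iff ?_).mpr fun j _ => ?_)
    · exact WithBot.bot_lt_coe _
    · rw [C_mul']
      refine (degree_smul_le _ _).trans_lt ?_
      rw [degree_prod]
      simp only [degree_X_sub_C, sum_const, nsmul_one, card_univ]
      exact_mod_cast card_lt_card (erase_ssubset (mem_univ j))
  · intro i _
    have hP : ∏ k ∈ univ.erase i, (x i - x k) ≠ 0 := prod_ne_zero_iff.mpr fun k hk =>
      sub_ne_zero.mpr fun h => ne_of_mem_erase hk (hx h).symm
    rw [eval_sub, eval_finsetSum, Finset.sum_eq_single i]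
    · simp only [eval_mul, eval_C, eval_prod, eval_sub, eval_X, Wc]
      rw [prod_eq_zero (mem_univ i) (sub_self _)]
      field_simp
      ring
    · intro j _ hj
      simp only [eval_mul, eval_C, eval_prod, eval_sub, eval_X]
      rw [prod_eq_zero (mem_erase.mpr ⟨hj.symm, mem_univ i⟩) (sub_self _), mul_zero]
    · simp

/-- Proinov, Theorem 4.1: the Dochev-Byrnev method is identical to the Prešić-Tanabe method. -/
theorem stmt_14 {n : ℕ} {K : Type*} [NormedField K] [CompleteSpace K] (hchar : (2 : K) ≠ 0)
    (hn : 2 ≤ n) (f : Polynomial K) (hdeg : f.degree = (n : ℕ))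
    (x : Fin n → K) (hx : Function.Injective x)
    (g : Polynomial K) (hg : g = C f.leadingCoeff * ∏ j, (X - C (x j))) :
    ∀ i : Fin n,
      x i - eval (x i) f / eval (x i) (derivative g) *
        (2 - eval (x i) (derivative f) / eval (x i) (derivative g) +
          (1 / 2 : K) * (eval (x i) f / eval (x i) (derivative g)) *
            (eval (x i) (derivative (derivative g)) / eval (x i) (derivative g))) =
      x i - Wc f x i * (1 - sigmaf f x i) := by
  intro i
  have hc : f.leadingCoeff ≠ 0 := leadingCoeff_ne_zero.mpr (by rintro rfl; simp at hdeg)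
  set c := f.leadingCoeff with hcdef
  set P : K[X] := ∏ k ∈ univ.erase i, (X - C (x k)) with hPdef
  have hPeval : eval (x i) P = ∏ k ∈ univ.erase i, (x i - x k) := by simp [hPdef, eval_prod]
  have hP : eval (x i) P ≠ 0 := hPeval ▸ prod_ne_zero_iff.mpr fun k hk =>
    sub_ne_zero.mpr fun h => ne_of_mem_erase hk (hx h).symm
  have hgP : g = C c * ((X - C (x i)) * P) := by
    rw [hg, hPdef, mul_prod_erase univ (fun k => X - C (x k)) (mem_univ i)]
  have hg' : eval (x i) (derivative g) = c * eval (x i) P := by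
    simp [hgP]
  have hg'' : eval (x i) (derivative (derivative g)) = c * (2 * eval (x i) (derivative P)) := by
    simp only [hgP, derivative_mul, derivative_C, derivative_sub, derivative_X, derivative_add,
      eval_mul, eval_add, eval_sub, eval_X, eval_C, eval_zero, eval_one, derivative_zero,
      derivative_one]
    ring
  have hW : eval (x i) f = Wc f x i * (c * eval (x i) P) := by
    rw [Wc, ← hPeval, div_mul_cancel₀ _ (mul_ne_zero hc hP)]
  have hf' : eval (x i) (derivative f) = c * eval (x i) P +
      c * Wc f x i * eval (x i) (derivative P) + c * eval (x i) P * sigmaf f x i := by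
    conv_lhs => rw [eq_nodal_add_sum_Wc hdeg hx, ← hcdef, ← hg]
    rw [derivative_add, eval_add, hg', derivative_sum, eval_finsetSum,
      ← add_sum_erase univ _ (mem_univ i), ← hPdef, derivative_C_mul, eval_C_mul, add_assoc,
      sigmaf, mul_sum]
    congr 2
    refine sum_congr rfl fun j hj => ?_
    have hji : j ≠ i := ne_of_mem_erase hj
    have hsub : x i - x j ≠ 0 := sub_ne_zero.mpr fun h => hji (hx h).symm
    rw [hPeval, ← mul_prod_erase _ (fun k => x i - x k) hj,
      ← mul_prod_erase (univ.erase j) (fun k => X - C (x k))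
        (mem_erase.mpr ⟨hji.symm, mem_univ i⟩), erase_right_comm]
    simp only [derivative_mul, derivative_C, derivative_sub, derivative_X, eval_mul, eval_add,
      eval_sub, eval_X, eval_C, eval_prod, eval_zero, eval_one, sub_self, zero_mul, sub_zero]
    field_simp
    ring
  rw [hg', hg'', hf', hW]
  field_simp
  ring
end
end
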